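/- Let I ⊆ R be a P-homogeneous ideal and ≼ a monomial order such that in_≼(I) is generated by monomials of total degree at most d. If G acts monomially on I up to degree d and the action of G is P-compatible, then the P-graded Hilbert series of I is G-invariant: for every g ∈ G (with induced automorphism ĝ of P) and every D ∈ P, dim_k I_D = dim_k I_{ĝ(D)}. -/

import Mathlib

open MvPolynomial

/-- The image of a monomial (exponent vector) under a permutation `g` of the variables. -/
noncomputable def actMon {n : ℕ} (g : Equiv.Perm (Fin n)) (a : Fin n →₀ ℕ) : Fin n →₀ ℕ :=
  Finsupp.mapDomain g a

/-- Total degree of an exponent vector. -/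
def tdeg {n : ℕ} (a : Fin n →₀ ℕ) : ℕ := a.sum fun _ e => e

/-- `le` is a monomial order. -/
def IsMonOrder {n : ℕ} (le : (Fin n →₀ ℕ) → (Fin n →₀ ℕ) → Prop) : Prop :=
  (∀ a b, le a b ∨ le b a) ∧ (∀ a b, le a b → le b a → a = b) ∧
    (∀ a b c, le a b → le b c → le a c) ∧ (∀ a, le 0 a) ∧
    (∀ a b c, le a b → le (a + c) (b + c))

/-- The initial ideal of `I` with respect to the monomial order `le`. -/
noncomputable def initIdeal {k : Type*} [Field k] {n : ℕ}
    (le : (Fin n →₀ ℕ) → (Fin n →₀ ℕ) → Prop) (I : Ideal (MvPolynomial (Fin n) k)) :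
    Ideal (MvPolynomial (Fin n) k) :=
  Ideal.span { m | ∃ f ∈ I, f ≠ 0 ∧ ∃ a ∈ f.support,
    (∀ b ∈ f.support, le b a) ∧ m = monomial a (1 : k) }

/-- `G` acts monomially on `I` up to degree `d`. -/
def MonomialActionUpTo {k : Type*} [Field k] {n : ℕ} {G : Type*} [Group G]
    (ρ : G →* Equiv.Perm (Fin n)) (I : Ideal (MvPolynomial (Fin n) k)) (d : ℕ) : Prop :=
  ∀ g : G, ∀ h ∈ I, h.totalDegree ≤ d →
    ∃ h' ∈ I, h'.support = h.support.image (actMon (ρ g))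

/-- The `P`-degree of a monomial, for the grading assigning degree `deg i` to `x_i`. -/
def mdeg {n : ℕ} {P : Type*} [AddCommMonoid P] (deg : Fin n → P) (a : Fin n →₀ ℕ) : P :=
  a.sum fun i e => e • deg i

/-- An ideal is `P`-homogeneous if it is generated by `P`-homogeneous elements. -/
def IsPHomog {k : Type*} [Field k] {n : ℕ} {P : Type*} [AddCommMonoid P]
    (deg : Fin n → P) (I : Ideal (MvPolynomial (Fin n) k)) : Prop :=
  ∃ S : Set (MvPolynomial (Fin n) k), I = Ideal.span S ∧
    ∀ f ∈ S, ∃ D : P, ∀ a ∈ f.support, mdeg deg a = D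

/-- The `k`-subspace of `P`-homogeneous polynomials of degree `D`. -/
noncomputable def degSub {k : Type*} [Field k] {n : ℕ} {P : Type*} [AddCommMonoid P]
    (deg : Fin n → P) (D : P) : Submodule k (MvPolynomial (Fin n) k) :=
  Submodule.span k
    ((fun a => (monomial a (1 : k) : MvPolynomial (Fin n) k)) '' { a | mdeg deg a = D })

/-- The degree-`D` graded piece `Q_D` of a `P`-homogeneous ideal `Q`: the `k`-vector space of
`P`-homogeneous elements of degree `D` lying in `Q`. -/
noncomputable def idealPiece {k : Type*} [Field k] {n : ℕ} {P : Type*} [AddCommMonoid P]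
    (Q : Ideal (MvPolynomial (Fin n) k)) (deg : Fin n → P) (D : P) :
    Submodule k (MvPolynomial (Fin n) k) :=
  Submodule.restrictScalars k Q ⊓ degSub deg D

/-- The degree-`D` graded piece `(R/Q)_D` of the quotient: the image in `R/Q` of the span of
the monomials of degree `D`. -/
noncomputable def quotPiece {k : Type*} [Field k] {n : ℕ} {P : Type*} [AddCommMonoid P]
    (Q : Ideal (MvPolynomial (Fin n) k)) (deg : Fin n → P) (D : P) :
    Submodule k
      (MvPolynomial (Fin n) k ⧸ Submodule.restrictScalars k Q) :=
  Submodule.map (Submodule.restrictScalars k Q).mkQ (degSub deg D)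

section HilbertSeries

variable {k : Type*} [Field k] {n : ℕ} {P : Type*} [AddCommMonoid P]

/-- The monomial `a` is the leading monomial of `f` with respect to `le`. -/
def IsLeadMon (le : (Fin n →₀ ℕ) → (Fin n →₀ ℕ) → Prop) (f : MvPolynomial (Fin n) k)
    (a : Fin n →₀ ℕ) : Prop :=
  a ∈ f.support ∧ ∀ b ∈ f.support, le b a

theorem IsMonOrder.exists_greatest {le : (Fin n →₀ ℕ) → (Fin n →₀ ℕ) → Prop}
    (hle : IsMonOrder le) {s : Finset (Fin n →₀ ℕ)} (hs : s.Nonempty) :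
    ∃ a ∈ s, ∀ b ∈ s, le b a := by
  obtain ⟨total, -, trans, -, -⟩ := hle
  induction hs using Finset.Nonempty.cons_induction with
  | singleton a => exact ⟨a, by simp, by simpa using total a a⟩
  | cons a s has hs ih =>
    obtain ⟨m, hm, hmax⟩ := ih
    rcases total a m with h | h
    · exact ⟨m, by simp [hm], by simpa [h] using hmax⟩
    · refine ⟨a, by simp, ?_⟩
      simpa using ⟨by simpa using total a a, fun b hb => trans _ _ _ (hmax b hb) h⟩

theorem mdeg_eq_weight (deg : Fin n → P) (a : Fin n →₀ ℕ) :
    mdeg deg a = Finsupp.weight deg a := rfl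

theorem mdeg_add (deg : Fin n → P) (a b : Fin n →₀ ℕ) :
    mdeg deg (a + b) = mdeg deg a + mdeg deg b := by
  simp only [mdeg_eq_weight, map_add]

theorem map_mdeg_eq_tdeg (deg : Fin n → P) (lam : P →+ ℕ) (hlam : ∀ i, lam (deg i) = 1)
    (a : Fin n →₀ ℕ) : lam (mdeg deg a) = tdeg a := by
  simp [mdeg, tdeg, Finsupp.sum, hlam]

theorem finite_setOf_mdeg_eq (deg : Fin n → P) (lam : P →+ ℕ) (hlam : ∀ i, lam (deg i) = 1)
    (D : P) : {a : Fin n →₀ ℕ | mdeg deg a = D}.Finite := by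
  refine (Finsupp.finite_of_degree_le (σ := Fin n) (lam D)).subset ?_
  rintro a rfl
  exact (map_mdeg_eq_tdeg deg lam hlam a).ge

theorem mem_degSub_iff (deg : Fin n → P) (D : P) (f : MvPolynomial (Fin n) k) :
    f ∈ degSub deg D ↔ ∀ a ∈ f.support, mdeg deg a = D := by
  rw [degSub, ← restrictSupport_eq_span, mem_restrictSupport_iff]
  rfl

theorem mem_idealPiece_iff (I : Ideal (MvPolynomial (Fin n) k)) (deg : Fin n → P) (D : P)
    (f : MvPolynomial (Fin n) k) :
    f ∈ idealPiece I deg D ↔ f ∈ I ∧ ∀ a ∈ f.support, mdeg deg a = D := by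
  rw [idealPiece, Submodule.mem_inf, mem_degSub_iff, Submodule.restrictScalars_mem]

theorem finiteDimensional_idealPiece (I : Ideal (MvPolynomial (Fin n) k)) (deg : Fin n → P)
    (lam : P →+ ℕ) (hlam : ∀ i, lam (deg i) = 1) (D : P) :
    FiniteDimensional k (idealPiece I deg D) := by
  have : FiniteDimensional k (degSub (k := k) deg D) :=
    FiniteDimensional.span_of_finite k ((finite_setOf_mdeg_eq deg lam hlam D).image _)
  exact Submodule.finiteDimensional_of_le (inf_le_right : idealPiece I deg D ≤ degSub deg D)

theorem IsPHomog.weightedHomogeneousComponent_mem {deg : Fin n → P}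
    {I : Ideal (MvPolynomial (Fin n) k)} (hI : IsPHomog deg I) {f : MvPolynomial (Fin n) k}
    (hf : f ∈ I) (D : P) : weightedHomogeneousComponent deg D f ∈ I := by
  classical
  let := weightedGradedAlgebra k deg
  refine MvPolynomial.weightedHomogeneousComponent_mem_of_mem k deg ?_ hf D
  obtain ⟨S, rfl, hS⟩ := hI
  refine Ideal.homogeneous_span _ _ fun f hf => ?_
  obtain ⟨D, hD⟩ := hS f hf
  exact ⟨D, fun a ha => hD a (mem_support_iff.mpr ha)⟩

theorem mem_support_mul_monomial_iff (f : MvPolynomial (Fin n) k) (e c : Fin n →₀ ℕ) :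
    c ∈ (f * monomial e (1 : k)).support ↔ ∃ b ∈ f.support, b + e = c := by
  classical
  rw [mem_support_iff, coeff_mul_monomial']
  constructor
  · intro h
    split_ifs at h with hec
    · exact ⟨c - e, by simpa using h, tsub_add_cancel_of_le hec⟩
    · exact absurd rfl h
  · rintro ⟨b, hb, rfl⟩
    simpa using hb

theorem actMon_injective (g : Equiv.Perm (Fin n)) : Function.Injective (actMon g) :=
  Finsupp.mapDomain_injective g.injective

theorem actMon_add (g : Equiv.Perm (Fin n)) (a b : Fin n →₀ ℕ) :
    actMon g (a + b) = actMon g a + actMon g b :=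
  Finsupp.mapDomain_add

theorem actMon_iterate (g : Equiv.Perm (Fin n)) (m : ℕ) (a : Fin n →₀ ℕ) :
    (actMon g)^[m] a = actMon (g ^ m) a := by
  induction m with
  | zero => simp [actMon, Finsupp.mapDomain_id]
  | succ m ih =>
    rw [Function.iterate_succ_apply', ih, pow_succ', actMon, actMon, actMon,
      ← Finsupp.mapDomain_comp, Equiv.Perm.coe_mul]

/-- The dimension of a subspace is at most the number of leading monomials of its elements. -/
theorem finrank_le_card_of_isLeadMon {le : (Fin n →₀ ℕ) → (Fin n →₀ ℕ) → Prop}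
    (hle : IsMonOrder le) (V : Submodule k (MvPolynomial (Fin n) k))
    (T : Finset (Fin n →₀ ℕ)) (hT : ∀ f ∈ V, ∀ a, IsLeadMon le f a → a ∈ T) :
    Module.finrank k V ≤ T.card := by
  let φ : V →ₗ[k] (T → k) := LinearMap.pi fun a => (lcoeff k a.1).comp V.subtype
  have hφ : Function.Injective φ := by
    rw [injective_iff_map_eq_zero]
    rintro ⟨f, hf⟩ h0
    by_contra hne
    have hf0 : f ≠ 0 := fun h => hne (Subtype.ext h)
    obtain ⟨a, ha, hmax⟩ := hle.exists_greatest (support_nonempty.mpr hf0)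
    exact mem_support_iff.mp ha (congrFun h0 ⟨a, hT f hf a ⟨ha, hmax⟩⟩)
  simpa using LinearMap.finrank_le_finrank_of_injective hφ

/-- Polynomials whose supports, pulled back along a map `u`, have distinct greatest elements are
linearly independent. -/
theorem linearIndependent_of_support_image {le : (Fin n →₀ ℕ) → (Fin n →₀ ℕ) → Prop}
    (hle : IsMonOrder le) (u : (Fin n →₀ ℕ) → (Fin n →₀ ℕ))
    (T : Finset (Fin n →₀ ℕ)) (F : T → MvPolynomial (Fin n) k)
    (hmem : ∀ a : T, u a ∈ (F a).support)
    (hmax : ∀ (a : T) (b : Fin n →₀ ℕ), u b ∈ (F a).support → le b a) :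
    LinearIndependent k F := by
  classical
  rw [Fintype.linearIndependent_iff]
  intro c hc
  by_contra! hne
  obtain ⟨i, hi⟩ := hne
  obtain ⟨m, hm, hgr⟩ := hle.exists_greatest
    (s := (Finset.univ.filter fun a : T => c a ≠ 0).image Subtype.val)
    ⟨i.1, Finset.mem_image_of_mem _ (by simpa using hi)⟩
  obtain ⟨m, hm, rfl⟩ := Finset.mem_image.mp hm
  have hcm : c m ≠ 0 := by simpa using hm
  have h := congrArg (coeff (u m)) hc
  rw [coeff_sum, Finset.sum_eq_single m, coeff_smul, coeff_zero, smul_eq_mul] at h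
  · exact mul_ne_zero hcm (mem_support_iff.mp (hmem m)) h
  · intro b _ hbm
    by_contra hb
    rw [coeff_smul, smul_eq_mul] at hb
    have h₁ : le b m :=
      hgr b (Finset.mem_image_of_mem _ (by simpa using left_ne_zero_of_mul hb))
    have h₂ : le m b := hmax b m (mem_support_iff.mpr (right_ne_zero_of_mul hb))
    exact hbm (Subtype.ext (hle.2.1 _ _ h₁ h₂))
  · simp

theorem exists_isLeadMon_le {le : (Fin n →₀ ℕ) → (Fin n →₀ ℕ) → Prop}
    {I : Ideal (MvPolynomial (Fin n) k)} {d : ℕ}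
    (hgen : ∃ S : Set (Fin n →₀ ℕ), (∀ a ∈ S, tdeg a ≤ d) ∧
      initIdeal le I =
        Ideal.span ((fun a => (monomial a (1 : k) : MvPolynomial (Fin n) k)) '' S))
    {f : MvPolynomial (Fin n) k} (hf : f ∈ I) {a : Fin n →₀ ℕ} (ha : IsLeadMon le f a) :
    ∃ p ∈ I, ∃ b, IsLeadMon le p b ∧ b ≤ a ∧ tdeg b ≤ d := by
  obtain ⟨S, hS, hspan⟩ := hgen
  have hlead : initIdeal le I = Ideal.span ((fun a => (monomial a (1 : k) :
      MvPolynomial (Fin n) k)) '' {b | ∃ p ∈ I, IsLeadMon le p b}) := by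
    rw [initIdeal]
    congr 1
    ext m
    constructor
    · rintro ⟨p, hp, -, b, hb, hmax, rfl⟩
      exact ⟨b, ⟨p, hp, hb, hmax⟩, rfl⟩
    · rintro ⟨b, ⟨p, hp, hb, hmax⟩, rfl⟩
      exact ⟨p, hp, support_nonempty.mp ⟨b, hb⟩, b, hb, hmax, rfl⟩
  have hain : (monomial a (1 : k) : MvPolynomial (Fin n) k) ∈ initIdeal le I := by
    rw [hlead]
    exact Ideal.subset_span ⟨a, ⟨f, hf, ha⟩, rfl⟩
  rw [hspan, mem_ideal_span_monomial_image] at hain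
  obtain ⟨s, hsS, hsa⟩ := hain a (by simp)
  have hsin : (monomial s (1 : k) : MvPolynomial (Fin n) k) ∈ initIdeal le I := by
    rw [hspan]
    exact Ideal.subset_span ⟨s, hsS, rfl⟩
  rw [hlead, mem_ideal_span_monomial_image] at hsin
  obtain ⟨b, ⟨p, hp, hpb⟩, hbs⟩ := hsin s (by simp)
  refine ⟨p, hp, b, hpb, hbs.trans hsa, le_trans ?_ (hS s hsS)⟩
  exact Finsupp.degree_mono hbs

theorem finrank_idealPiece_le {G : Type*} [Group G] (deg : Fin n → P)
    (lam : P →+ ℕ) (hlam : ∀ i, lam (deg i) = 1)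
    (ρ : G →* Equiv.Perm (Fin n)) {I : Ideal (MvPolynomial (Fin n) k)} (hI : IsPHomog deg I)
    {le : (Fin n →₀ ℕ) → (Fin n →₀ ℕ) → Prop} (hle : IsMonOrder le) {d : ℕ}
    (hgen : ∃ S : Set (Fin n →₀ ℕ), (∀ a ∈ S, tdeg a ≤ d) ∧
      initIdeal le I =
        Ideal.span ((fun a => (monomial a (1 : k) : MvPolynomial (Fin n) k)) '' S))
    (hmon : MonomialActionUpTo ρ I d) (g : G) (ghat : P → P)
    (hg : ∀ a : Fin n →₀ ℕ, mdeg deg (actMon (ρ g) a) = ghat (mdeg deg a)) (D : P) :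
    Module.finrank k (idealPiece I deg D) ≤ Module.finrank k (idealPiece I deg (ghat D)) := by
  classical
  have hfin : {a | ∃ f ∈ idealPiece I deg D, IsLeadMon le f a}.Finite := by
    refine (finite_setOf_mdeg_eq deg lam hlam D).subset ?_
    rintro a ⟨f, hf, ha⟩
    exact ((mem_idealPiece_iff I deg D f).mp hf).2 a ha.1
  have key : ∀ a : hfin.toFinset, ∃ F ∈ idealPiece I deg (ghat D),
      actMon (ρ g) a ∈ F.support ∧ ∀ b, actMon (ρ g) b ∈ F.support → le b a := by
    rintro ⟨a, ha⟩
    obtain ⟨f, hf, hfa⟩ := hfin.mem_toFinset.mp ha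
    rw [mem_idealPiece_iff] at hf
    have haD : mdeg deg a = D := hf.2 a hfa.1
    obtain ⟨p, hp, b, hpb, hba, hbd⟩ := exists_isLeadMon_le hgen hf.1 hfa
    obtain ⟨e, rfl⟩ := exists_add_of_le hba
    have hq := hI.weightedHomogeneousComponent_mem hp (mdeg deg b)
    set q := weightedHomogeneousComponent deg (mdeg deg b) p with hqdef
    have hqsupp : ∀ c, c ∈ q.support ↔ c ∈ p.support ∧ mdeg deg c = mdeg deg b := by
      intro c
      rw [hqdef, support_weightedHomogeneousComponent, Finset.mem_filter, mdeg_eq_weight deg c]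
    have hqd : q.totalDegree ≤ d := by
      refine Finset.sup_le fun c hc => ?_
      change tdeg c ≤ d
      rwa [← map_mdeg_eq_tdeg deg lam hlam, ((hqsupp c).mp hc).2,
        map_mdeg_eq_tdeg deg lam hlam]
    obtain ⟨q', hq', hq'supp⟩ := hmon g q hq hqd
    have hF : ∀ c, c ∈ (q' * monomial (actMon (ρ g) e) (1 : k)).support ↔
        ∃ b ∈ q.support, actMon (ρ g) (b + e) = c := by
      intro c
      simp [mem_support_mul_monomial_iff, hq'supp, actMon_add, -mem_support_iff]
    refine ⟨q' * monomial (actMon (ρ g) e) 1, ?_, ?_, ?_⟩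
    · rw [mem_idealPiece_iff]
      refine ⟨I.mul_mem_right _ hq', fun c hc => ?_⟩
      obtain ⟨c', hc', rfl⟩ := (hF c).mp hc
      rw [hg, mdeg_add, ((hqsupp c').mp hc').2, ← mdeg_add, haD]
    · exact (hF _).mpr ⟨b, (hqsupp b).mpr ⟨hpb.1, rfl⟩, rfl⟩
    · intro c hc
      obtain ⟨c', hc', hcc⟩ := (hF _).mp hc
      rw [← actMon_injective _ hcc]
      exact hle.2.2.2.2 _ _ _ (hpb.2 c' ((hqsupp c').mp hc').1)
  choose F hFmem hFlead hFmax using key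
  have := finiteDimensional_idealPiece I deg lam hlam (ghat D)
  have hind : LinearIndependent k
      (fun a => ⟨F a, hFmem a⟩ : hfin.toFinset → idealPiece I deg (ghat D)) :=
    LinearIndependent.of_comp (idealPiece I deg (ghat D)).subtype
      (linearIndependent_of_support_image hle (actMon (ρ g)) _ F hFlead hFmax)
  calc Module.finrank k (idealPiece I deg D) ≤ hfin.toFinset.card :=
        finrank_le_card_of_isLeadMon hle _ _ fun f hf a ha => hfin.mem_toFinset.mpr ⟨f, hf, ha⟩
    _ ≤ _ := by simpa only [Fintype.card_coe] using hind.fintype_card_le_finrank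

theorem idealPiece_eq_bot (I : Ideal (MvPolynomial (Fin n) k)) (deg : Fin n → P) {D : P}
    (hD : ∀ a, mdeg deg a ≠ D) : idealPiece I deg D = ⊥ := by
  refine (Submodule.eq_bot_iff _).mpr fun f hf => ?_
  by_contra hf0
  obtain ⟨a, ha⟩ := support_nonempty.mpr hf0
  exact hD a (((mem_idealPiece_iff I deg D f).mp hf).2 a ha)

end HilbertSeries

/-- Let `I` be a `P`-homogeneous ideal with `in_≼(I)` generated by monomials of
total degree at most `d`. If `G` acts monomially on `I` up to degree `d` and the action is
`P`-compatible, then the `P`-graded Hilbert series of `I` is `G`-invariant: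
`dim_k I_D = dim_k I_{ĝ(D)}` for all `g ∈ G` and `D ∈ P`. -/
theorem stmt3 {k : Type*} [Field k] {n : ℕ} {G : Type*} [Group G]
    {P : Type*} [AddCommMonoid P] (deg : Fin n → P)
    (lam : P →+ ℕ) (hlam : ∀ i, lam (deg i) = 1)
    (ρ : G →* Equiv.Perm (Fin n)) (I : Ideal (MvPolynomial (Fin n) k))
    (hI : IsPHomog deg I)
    (le : (Fin n →₀ ℕ) → (Fin n →₀ ℕ) → Prop) (hle : IsMonOrder le)
    (d : ℕ)
    (hgen : ∃ S : Set (Fin n →₀ ℕ), (∀ a ∈ S, tdeg a ≤ d) ∧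
      initIdeal le I =
        Ideal.span ((fun a => (monomial a (1 : k) : MvPolynomial (Fin n) k)) '' S))
    (hmon : MonomialActionUpTo ρ I d)
    (hcomp : ∀ g : G, ∃ ghat : P ≃+ P,
      ∀ a : Fin n →₀ ℕ, mdeg deg (actMon (ρ g) a) = ghat (mdeg deg a))
    (g : G) (ghat : P ≃+ P)
    (hg : ∀ a : Fin n →₀ ℕ, mdeg deg (actMon (ρ g) a) = ghat (mdeg deg a))
    (D : P) :
    Module.finrank k (idealPiece I deg D) = Module.finrank k (idealPiece I deg (ghat D)) := by
  have hle_step (E : P) := finrank_idealPiece_le deg lam hlam ρ hI hle hgen hmon g ghat hg E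
  by_cases hD : ∃ a, mdeg deg a = D
  · obtain ⟨a, rfl⟩ := hD
    refine (hle_step _).antisymm ?_
    have hiter (m : ℕ) (E : P) : Module.finrank k (idealPiece I deg E) ≤
        Module.finrank k (idealPiece I deg (ghat^[m] E)) := by
      induction m with
      | zero => rfl
      | succ m ih =>
        rw [Function.iterate_succ_apply']
        exact ih.trans (hle_step _)
    have hdeg (m : ℕ) : ghat^[m] (mdeg deg a) = mdeg deg ((actMon (ρ g))^[m] a) := by
      induction m with
      | zero => rfl
      | succ m ih => rw [Function.iterate_succ_apply', ih, Function.iterate_succ_apply', hg]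
    obtain ⟨m, hm⟩ := Nat.exists_eq_succ_of_ne_zero (orderOf_pos (ρ g)).ne'
    have hback : ghat^[m] (ghat (mdeg deg a)) = mdeg deg a := by
      rw [← Function.iterate_succ_apply, hdeg, actMon_iterate, ← hm, pow_orderOf_eq_one]
      simp [actMon, Finsupp.mapDomain_id]
    exact (hiter m (ghat (mdeg deg a))).trans_eq (by rw [hback])
  · push Not at hD
    have hD' : ∀ a, mdeg deg a ≠ ghat D := by
      intro a ha
      refine hD (actMon (ρ g)⁻¹ a) (ghat.injective ?_)
      rw [← hg, ← ha, actMon, actMon, ← Finsupp.mapDomain_comp, ← Equiv.Perm.coe_mul,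
        mul_inv_cancel, Equiv.Perm.coe_one, Finsupp.mapDomain_id]
    rw [idealPiece_eq_bot I deg hD, idealPiece_eq_bot I deg hD', finrank_bot]
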